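/- Let N ≥ 3, K(y) = exp(|y|²/4), 2* = 2N/(N−2), p = 2*−1, β = (N−2)/4, μ ∈ [0, (N−2)²/8]. The function δ ↦ d(δ) = inf{ E_K(v) : v ∈ 𝒩_δ } is strictly increasing on 0 < δ ≤ 1, strictly decreasing on 1 ≤ δ < (p+1)/2, and attains its maximum d = d(1) at δ = 1; that is, d(δ) < d(1) for every δ ∈ (0, (p+1)/2) with δ ≠ 1. -/

import Mathlib

open MeasureTheory Real Set

noncomputable section

abbrev Euc (N : ℕ) := EuclideanSpace ℝ (Fin N)

def Kw {N : ℕ} (x : Euc N) : ℝ := Real.exp (‖x‖ ^ 2 / 4)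

def twoStar (N : ℕ) : ℝ := 2 * N / ((N : ℝ) - 2)

structure MemX {N : ℕ} (v : Euc N → ℝ) : Prop where
  diff : Differentiable ℝ v
  int_grad : Integrable fun x => ‖gradient v x‖ ^ 2 * Kw x
  int_sq : Integrable fun x => v x ^ 2 * Kw x
  int_hardy : Integrable fun x => v x ^ 2 / ‖x‖ ^ 2 * Kw x
  int_crit : Integrable fun x => |v x| ^ twoStar N * Kw x

def Afun {N : ℕ} (μ : ℝ) (v : Euc N → ℝ) : ℝ :=
  ∫ x, (‖gradient v x‖ ^ 2 - μ * v x ^ 2 / ‖x‖ ^ 2 - ((N : ℝ) - 2) / 4 * v x ^ 2) * Kw x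

def Bfun {N : ℕ} (v : Euc N → ℝ) : ℝ := ∫ x, |v x| ^ twoStar N * Kw x

def EKf {N : ℕ} (μ : ℝ) (v : Euc N → ℝ) : ℝ := Afun μ v / 2 - Bfun v / twoStar N

def DK {N : ℕ} (μ : ℝ) (v : Euc N → ℝ) : ℝ := Afun μ v - Bfun v

def DKd {N : ℕ} (μ δ : ℝ) (v : Euc N → ℝ) : ℝ := δ * Afun μ v - Bfun v

def normKp1Sq {N : ℕ} (v : Euc N → ℝ) : ℝ := Bfun v ^ (2 / twoStar N)

def SK (N : ℕ) (μ : ℝ) : ℝ :=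
  sInf { r | ∃ v : Euc N → ℝ, MemX v ∧ v ≠ 0 ∧ r = Afun μ v / normKp1Sq v }

def rdel (N : ℕ) (μ δ : ℝ) : ℝ := δ ^ (((N : ℝ) - 2) / 2) * SK N μ ^ ((N : ℝ) / 2)

def gradNormSq {N : ℕ} (v : Euc N → ℝ) : ℝ := ∫ x, ‖gradient v x‖ ^ 2 * Kw x

def normKsq {N : ℕ} (v : Euc N → ℝ) : ℝ := ∫ x, v x ^ 2 * Kw x

def ddepth (N : ℕ) (μ δ : ℝ) : ℝ :=
  sInf { e | ∃ v : Euc N → ℝ, MemX v ∧ DKd μ δ v = 0 ∧ gradNormSq v ≠ 0 ∧ e = EKf μ v }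

def dwell (N : ℕ) (μ : ℝ) : ℝ :=
  sInf { e | ∃ v : Euc N → ℝ, MemX v ∧ v ≠ 0 ∧ DK μ v = 0 ∧ e = EKf μ v }

open scoped ENNReal NNReal Topology Pointwise

theorem HasCompactSupport.enorm_le_lintegral_enorm_deriv {u : ℝ → ℝ} (hu : Differentiable ℝ u)
    (h2u : HasCompactSupport u) (x : ℝ) : ‖u x‖ₑ ≤ ∫⁻ y, ‖deriv u y‖ₑ := by
  by_cases htop : ∫⁻ y, ‖deriv u y‖ₑ = ⊤
  · simp [htop]
  have hint : Integrable (deriv u) :=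
    ⟨(measurable_deriv u).aestronglyMeasurable, lt_top_iff_ne_top.2 htop⟩
  have hlim : Filter.Tendsto u Filter.atBot (𝓝 0) :=
    h2u.is_zero_at_infty.mono_left _root_.atBot_le_cocompact
  have h := integral_Iic_of_hasDerivAt_of_tendsto' (a := x) (fun y _ => (hu y).hasDerivAt)
    hint.integrableOn hlim
  rw [sub_zero] at h
  rw [← h]
  exact (enorm_integral_le_lintegral_enorm _).trans
    (lintegral_mono' Measure.restrict_le_self le_rfl)

theorem lintegral_rpow_le_lintegral_fderiv_pi_of_differentiable {ι : Type*} [Fintype ι]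
    {p : ℝ} (hp : Real.HolderConjugate (Fintype.card ι) p)
    {u : (ι → ℝ) → ℝ} (hu : Differentiable ℝ u) (h2u : HasCompactSupport u) :
    ∫⁻ x, ‖u x‖ₑ ^ p ≤ (∫⁻ x, ‖fderiv ℝ u x‖ₑ) ^ p := by
  classical
  have : (1 : ℝ) ≤ ↑(Fintype.card ι) - 1 := by
    have hι : (2 : ℝ) ≤ Fintype.card ι := by exact_mod_cast hp.lt
    linarith
  calc ∫⁻ x, ‖u x‖ₑ ^ p
      = ∫⁻ x, (‖u x‖ₑ ^ (1 / (Fintype.card ι - 1 : ℝ))) ^ (Fintype.card ι : ℝ) := by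
        congr! 2 with x
        rw [← ENNReal.rpow_mul, hp.conjugate_eq]
        field_simp
    _ = ∫⁻ x, ∏ _i : ι, ‖u x‖ₑ ^ (1 / (Fintype.card ι - 1 : ℝ)) := by
        congr! 2 with x
        simp_rw [Finset.prod_const]
        norm_cast
    _ ≤ ∫⁻ x, ∏ i, (∫⁻ xᵢ, ‖fderiv ℝ u (Function.update x i xᵢ)‖ₑ) ^
          ((1 : ℝ) / (Fintype.card ι - 1 : ℝ)) := ?_
    _ ≤ (∫⁻ x, ‖fderiv ℝ u x‖ₑ) ^ p := by
        apply lintegral_prod_lintegral_pow_le _ hp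
        exact (measurable_fderiv ℝ u).enorm
  gcongr with x i
  calc ‖u x‖ₑ
    _ ≤ ∫⁻ xᵢ, ‖deriv (u ∘ Function.update x i) xᵢ‖ₑ := by
        refine le_trans (by simp) (HasCompactSupport.enorm_le_lintegral_enorm_deriv
          (u := u ∘ Function.update x i) ?_ ?_ (x i))
        · exact hu.comp fun y => (hasDerivAt_update x i y).differentiableAt
        · exact h2u.comp_isClosedEmbedding (isClosedEmbedding_update x i)
    _ ≤ ∫⁻ xᵢ, ‖fderiv ℝ u (Function.update x i xᵢ)‖ₑ := ?_
  gcongr with y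
  calc ‖deriv (u ∘ Function.update x i) y‖ₑ
      = ‖fderiv ℝ u (Function.update x i y) (deriv (Function.update x i) y)‖ₑ := by
        rw [fderiv_comp_deriv _ hu.differentiableAt
          (hasDerivAt_update x i y).differentiableAt]
    _ ≤ ‖fderiv ℝ u (Function.update x i y)‖ₑ * ‖deriv (Function.update x i) y‖ₑ :=
        ContinuousLinearMap.le_opENorm _ _
    _ ≤ ‖fderiv ℝ u (Function.update x i y)‖ₑ := by simp [deriv_update, Pi.enorm_single]

theorem exists_lintegral_rpow_le_lintegral_fderiv_of_differentiable {N : ℕ} {p : ℝ}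
    (hp : Real.HolderConjugate N p) :
    ∃ C : ℝ≥0, ∀ u : Euc N → ℝ, Differentiable ℝ u → HasCompactSupport u →
      ∫⁻ x, ‖u x‖ₑ ^ p ≤ C * (∫⁻ x, ‖fderiv ℝ u x‖ₑ) ^ p := by
  have h0p : 0 ≤ p := hp.symm.nonneg
  let e : Euc N ≃L[ℝ] (Fin N → ℝ) := EuclideanSpace.equiv (Fin N) ℝ
  have he : MeasurePreserving e.symm := PiLp.volume_preserving_toLp (Fin N)
  have hemb : MeasurableEmbedding e.symm := e.symm.toHomeomorph.measurableEmbedding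
  refine ⟨‖(e.symm : (Fin N → ℝ) →L[ℝ] Euc N)‖₊ ^ p, fun u hu h2u => ?_⟩
  have hv : Differentiable ℝ (u ∘ e.symm) := hu.comp e.symm.differentiable
  have h2v : HasCompactSupport (u ∘ e.symm) := h2u.comp_homeomorph e.symm.toHomeomorph
  calc ∫⁻ x, ‖u x‖ₑ ^ p = ∫⁻ y, ‖(u ∘ e.symm) y‖ₑ ^ p :=
        (he.lintegral_comp_emb hemb fun x => ‖u x‖ₑ ^ p).symm
    _ ≤ (∫⁻ y, ‖fderiv ℝ (u ∘ e.symm) y‖ₑ) ^ p :=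
        lintegral_rpow_le_lintegral_fderiv_pi_of_differentiable (by simpa using hp) hv h2v
    _ ≤ (∫⁻ y, ‖(e.symm : (Fin N → ℝ) →L[ℝ] Euc N)‖ₑ * ‖fderiv ℝ u (e.symm y)‖ₑ) ^ p := by
        gcongr with y
        rw [fderiv_comp _ hu.differentiableAt e.symm.differentiableAt, e.symm.fderiv, mul_comm]
        apply ContinuousLinearMap.opENorm_comp_le
    _ = _ := by
        rw [lintegral_const_mul' _ _ enorm_ne_top,
          he.lintegral_comp_emb hemb fun x => ‖fderiv ℝ u x‖ₑ,
          ENNReal.mul_rpow_of_nonneg _ _ h0p, enorm_eq_nnnorm, ← ENNReal.coe_rpow_of_nonneg _ h0p]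

theorem twoStar_gt_two {N : ℕ} (hN : 3 ≤ N) : 2 < twoStar N := by
  have h : (3 : ℝ) ≤ N := by exact_mod_cast hN
  rw [twoStar, lt_div_iff₀ (by linarith)]
  linarith

theorem lintegral_rpow_twoStar_le {N : ℕ} (hN : 3 ≤ N) :
    ∃ C : ℝ≥0, ∀ w : Euc N → ℝ, Differentiable ℝ w → HasCompactSupport w →
      ∫⁻ x, ‖w x‖ₑ ^ twoStar N ≤ C * ((∫⁻ x, ‖w x‖ₑ ^ twoStar N) ^ (1 / 2 : ℝ) *
        (∫⁻ x, ‖fderiv ℝ w x‖ₑ ^ (2 : ℝ)) ^ (1 / 2 : ℝ)) ^ ((N : ℝ) / (N - 1)) := by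
  have hN' : (3 : ℝ) ≤ N := by exact_mod_cast hN
  have hp : Real.HolderConjugate N ((N : ℝ) / (N - 1)) := .conjExponent (by linarith)
  set q : ℝ := (N : ℝ) / (N - 1)
  have hq0 : 0 ≤ q := hp.symm.nonneg
  obtain ⟨C, hC⟩ := exists_lintegral_rpow_le_lintegral_fderiv_of_differentiable hp
  let γ : ℝ≥0 := ⟨2 * ((N : ℝ) - 1) / (N - 2), div_nonneg (by linarith) (by linarith)⟩
  have hγ : (γ : ℝ) = 2 * ((N : ℝ) - 1) / (N - 2) := rfl
  have h1 : (N : ℝ) - 1 ≠ 0 := by linarith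
  have h2 : (N : ℝ) - 2 ≠ 0 := by linarith
  have hγ1 : 1 < γ := by
    rw [← NNReal.coe_lt_coe, hγ, NNReal.coe_one, lt_div_iff₀ (by linarith)]
    linarith
  have hγq : (γ : ℝ) * q = twoStar N := by
    simp only [hγ, q, twoStar]
    field_simp
  have hγ2 : ((γ : ℝ) - 1) * 2 = twoStar N := by
    simp only [hγ, twoStar]
    field_simp
    ring
  refine ⟨C * γ ^ q, fun w hw h2w => ?_⟩
  have hγ0 : (γ : ℝ) ≠ 0 := by
    have : (1 : ℝ) < γ := by exact_mod_cast hγ1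
    positivity
  have hdiff : Differentiable ℝ fun x => ‖w x‖ ^ (γ : ℝ) :=
    (differentiable_norm_rpow (by exact_mod_cast hγ1)).comp hw
  have hsupp : HasCompactSupport fun x => ‖w x‖ ^ (γ : ℝ) :=
    h2w.comp_left (g := fun t : ℝ => ‖t‖ ^ (γ : ℝ)) (by simp [hγ0])
  calc ∫⁻ x, ‖w x‖ₑ ^ twoStar N = ∫⁻ x, ‖‖w x‖ ^ (γ : ℝ)‖ₑ ^ q := by
        congr! 2 with x
        rw [Real.enorm_rpow_of_nonneg (norm_nonneg (w x)) γ.coe_nonneg, enorm_norm, ← ENNReal.rpow_mul, hγq]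
    _ ≤ C * (∫⁻ x, ‖fderiv ℝ (fun x => ‖w x‖ ^ (γ : ℝ)) x‖ₑ) ^ q := hC _ hdiff hsupp
    _ ≤ C * (γ * ∫⁻ x, ‖w x‖ₑ ^ ((γ : ℝ) - 1) * ‖fderiv ℝ w x‖ₑ) ^ q := by
        rw [← lintegral_const_mul' _ _ ENNReal.coe_ne_top]
        gcongr with x
        rw [← mul_assoc]
        exact enorm_fderiv_norm_rpow_le hw hγ1
    _ ≤ C * (γ * ((∫⁻ x, ‖w x‖ₑ ^ twoStar N) ^ (1 / 2 : ℝ) *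
        (∫⁻ x, ‖fderiv ℝ w x‖ₑ ^ (2 : ℝ)) ^ (1 / 2 : ℝ))) ^ q := by
        gcongr
        refine (ENNReal.lintegral_mul_le_Lp_mul_Lq volume Real.HolderConjugate.two_two
          (hw.continuous.measurable.enorm.pow_const _).aemeasurable
          (measurable_fderiv ℝ w).enorm.aemeasurable).trans_eq ?_
        simp_rw [← ENNReal.rpow_mul, hγ2]
    _ = _ := by
        rw [ENNReal.mul_rpow_of_nonneg _ _ hq0, ← mul_assoc, ENNReal.coe_mul,
          ENNReal.coe_rpow_of_nonneg _ hq0]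

theorem sobolev_of_differentiable {N : ℕ} (hN : 3 ≤ N) :
    ∃ S : ℝ, 0 < S ∧ ∀ w : Euc N → ℝ, Differentiable ℝ w → HasCompactSupport w →
      Integrable (fun x => ‖fderiv ℝ w x‖ ^ 2) →
      S * (∫ x, |w x| ^ twoStar N) ^ (2 / twoStar N) ≤ ∫ x, ‖fderiv ℝ w x‖ ^ 2 := by
  have hN' : (3 : ℝ) ≤ N := by exact_mod_cast hN
  have hs := twoStar_gt_two hN
  obtain ⟨C, hC⟩ := lintegral_rpow_twoStar_le hN
  set q : ℝ := (N : ℝ) / (N - 1) with hq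
  have hq0 : 0 < q := div_pos (by linarith) (by linarith)
  set D : ℝ := ((C : ℝ) + 1) ^ (2 / q)
  have hD : 0 < D := by positivity
  refine ⟨D⁻¹, by positivity, fun w hw h2w hint => ?_⟩
  have hcont : Continuous fun x => |w x| ^ twoStar N :=
    hw.continuous.abs.rpow_const fun _ => Or.inr (by linarith)
  have hBint : Integrable fun x => |w x| ^ twoStar N :=
    hcont.integrable_of_hasCompactSupport
      (h2w.comp_left (g := fun t : ℝ => |t| ^ twoStar N) (by
        simp [Real.zero_rpow (show twoStar N ≠ 0 by linarith)]))
  have hb0 : 0 ≤ ∫ x, |w x| ^ twoStar N := integral_nonneg fun x => by positivity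
  have hg0 : 0 ≤ ∫ x, ‖fderiv ℝ w x‖ ^ 2 := integral_nonneg fun x => by positivity
  have hB : ∫⁻ x, ‖w x‖ₑ ^ twoStar N = ENNReal.ofReal (∫ x, |w x| ^ twoStar N) := by
    rw [ofReal_integral_eq_lintegral_ofReal hBint (.of_forall fun x => by positivity)]
    congr! 2 with x
    rw [← ENNReal.ofReal_rpow_of_nonneg (abs_nonneg _) (by linarith), Real.enorm_eq_ofReal_abs]
  have hG : ∫⁻ x, ‖fderiv ℝ w x‖ₑ ^ (2 : ℝ) = ENNReal.ofReal (∫ x, ‖fderiv ℝ w x‖ ^ 2) := by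
    rw [ofReal_integral_eq_lintegral_ofReal hint (.of_forall fun x => by positivity)]
    congr! 2 with x
    rw [ENNReal.ofReal_pow (norm_nonneg _), ofReal_norm, ENNReal.rpow_two]
  have key := hC w hw h2w
  rw [hB, hG] at key
  set b := ∫ x, |w x| ^ twoStar N
  set g := ∫ x, ‖fderiv ℝ w x‖ ^ 2
  have key' : b ≤ (C + 1) * (b ^ (1 / 2 : ℝ) * g ^ (1 / 2 : ℝ)) ^ q := by
    rw [ENNReal.ofReal_rpow_of_nonneg hb0 (by norm_num),
      ENNReal.ofReal_rpow_of_nonneg hg0 (by norm_num), ← ENNReal.ofReal_mul (by positivity),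
      ENNReal.ofReal_rpow_of_nonneg (by positivity) hq0.le, ← ENNReal.ofReal_coe_nnreal,
      ← ENNReal.ofReal_mul (by positivity), ENNReal.ofReal_le_ofReal_iff (by positivity)] at key
    refine key.trans ?_
    gcongr
    linarith
  rw [inv_mul_le_iff₀ hD]
  rcases hb0.eq_or_lt with hb | hb
  · rw [← hb, Real.zero_rpow (by positivity)]
    positivity
  have hexp : 2 / q = 2 / twoStar N + 1 := by
    rw [hq, twoStar]
    have h1 : (N : ℝ) - 1 ≠ 0 := by linarith
    have h2 : (N : ℝ) - 2 ≠ 0 := by linarith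
    have h3 : (N : ℝ) ≠ 0 := by linarith
    field_simp
    ring
  have h3 := Real.rpow_le_rpow hb0 key' (show 0 ≤ 2 / q by positivity)
  rw [Real.mul_rpow (by positivity) (by positivity), ← Real.rpow_mul (by positivity),
    mul_div_cancel₀ _ hq0.ne', Real.mul_rpow (by positivity) (by positivity),
    ← Real.rpow_mul hb0, ← Real.rpow_mul hg0, one_div_mul_cancel two_ne_zero, Real.rpow_one,
    Real.rpow_one, hexp, Real.rpow_add_one hb.ne'] at h3
  have h4 : b ^ (2 / twoStar N) * b ≤ (D * g) * b := by
    simp only [D, hexp] at h3 ⊢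
    linarith
  exact le_of_mul_le_mul_right h4 hb

theorem locallyIntegrable_fderiv_of_integrable_sq {N : ℕ} {w : Euc N → ℝ}
    (h : Integrable fun x => ‖fderiv ℝ w x‖ ^ 2) : LocallyIntegrable (fderiv ℝ w) :=
  ((memLp_two_iff_integrable_sq_norm (measurable_fderiv ℝ w).aestronglyMeasurable).2
    h).locallyIntegrable one_le_two

theorem integral_radial_divergence {N : ℕ} {w g : Euc N → ℝ} (hw : Differentiable ℝ w)
    (h2w : HasCompactSupport w) (hloc : LocallyIntegrable (fderiv ℝ w)) (hg : ContDiff ℝ 1 g) :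
    Integrable (fun x => N * (w x ^ 2 * g x) +
      (2 * w x * g x * fderiv ℝ w x x + w x ^ 2 * fderiv ℝ g x x)) ∧
    ∫ x, (N * (w x ^ 2 * g x) +
      (2 * w x * g x * fderiv ℝ w x x + w x ^ 2 * fderiv ℝ g x x)) = 0 := by
  set h : Euc N → ℝ := fun x => w x ^ 2 * g x with hh
  have hgd : Differentiable ℝ g := hg.differentiable one_ne_zero
  have hd : Differentiable ℝ h := (hw.pow 2).mul hgd
  have hfd : ∀ x, fderiv ℝ h x = (2 * w x * g x) • fderiv ℝ w x + (w x ^ 2) • fderiv ℝ g x := by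
    intro x
    have h1 := ((hw x).hasFDerivAt.pow 2).mul (hgd x).hasFDerivAt
    rw [show h = (fun y => w y ^ 2) * g from rfl, HasFDerivAt.fderiv h1, add_comm]
    ext y
    simp
    ring
  have hwc := hw.continuous
  have hgc := hgd.continuous
  have hφ : ∀ φ : Euc N → ℝ, Continuous φ → ∀ e,
      Integrable fun x => φ x * fderiv ℝ h x e := by
    intro φ hφ e
    have i1 : Integrable fun x => (φ x * (2 * w x * g x)) • fderiv ℝ w x := by
      refine hloc.integrable_smul_left_of_hasCompactSupport (by fun_prop) ?_
      refine h2w.mono' fun x hx => subset_tsupport w fun h0 => hx ?_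
      simp [h0]
    have i2 : Integrable fun x => (φ x * w x ^ 2) • fderiv ℝ g x := by
      refine (hg.continuous_fderiv one_ne_zero).locallyIntegrable
        |>.integrable_smul_left_of_hasCompactSupport (by fun_prop) ?_
      refine h2w.mono' fun x hx => subset_tsupport w fun h0 => hx ?_
      simp [h0]
    refine ((i1.apply_continuousLinearMap e).add (i2.apply_continuousLinearMap e)).congr
      (.of_forall fun x => ?_)
    simp [hfd]
    ring
  have hsupp : HasCompactSupport h :=
    h2w.mono' fun x hx => subset_tsupport w fun h0 => hx (by simp [hh, h0])
  have hint : Integrable h := hd.continuous.integrable_of_hasCompactSupport hsupp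
  have hcoord : ∀ i : Fin N,
      Integrable (fun x => fderiv ℝ h x (EuclideanSpace.single i 1) * x i) ∧
      ∫ x, fderiv ℝ h x (EuclideanSpace.single i 1) * x i = -∫ x, h x := by
    intro i
    have hi : Integrable fun x => fderiv ℝ h x (EuclideanSpace.single i 1) * x i := by
      simpa only [mul_comm] using hφ (fun x => x i) (by fun_prop) (EuclideanSpace.single i 1)
    refine ⟨hi, ?_⟩
    have hfi : ∀ x : Euc N,
        fderiv ℝ (fun x : Euc N => x i) x (EuclideanSpace.single i 1) = 1 := fun x => by
      rw [show (fun x : Euc N => x i) = (EuclideanSpace.proj i : Euc N →L[ℝ] ℝ) from rfl,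
        ContinuousLinearMap.fderiv]
      simp
    have hc : Continuous fun x : Euc N => x i := by fun_prop
    have h1 := integral_mul_fderiv_eq_neg_fderiv_mul_of_integrable (μ := volume) (f := h)
      (g := fun x : Euc N => x i) (v := EuclideanSpace.single i 1) hi
      (by simpa only [hfi, mul_one] using hint)
      ((hd.continuous.mul hc).integrable_of_hasCompactSupport hsupp.mul_right)
      (fun x _ => hd x) (fun x _ => by fun_prop)
    simp only [hfi, mul_one] at h1
    rw [h1, neg_neg]
  have hsum : ∀ x : Euc N,
      fderiv ℝ h x x = ∑ i, fderiv ℝ h x (EuclideanSpace.single i 1) * x i := by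
    intro x
    have hx := congrArg (fderiv ℝ h x) ((EuclideanSpace.basisFun (Fin N) ℝ).sum_repr x)
    rw [← hx]
    simp [mul_comm]
  have heq : (fun x => N * (w x ^ 2 * g x) +
      (2 * w x * g x * fderiv ℝ w x x + w x ^ 2 * fderiv ℝ g x x)) =
      fun x => N * h x + ∑ i, fderiv ℝ h x (EuclideanSpace.single i 1) * x i := by
    funext x
    rw [← hsum, hfd]
    simp [hh]
  rw [heq]
  have hs : Integrable fun x => ∑ i, fderiv ℝ h x (EuclideanSpace.single i 1) * x i :=
    integrable_finsetSum _ fun i _ => (hcoord i).1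
  refine ⟨(hint.const_mul _).add hs, ?_⟩
  rw [integral_add (hint.const_mul _) hs, integral_finsetSum _ fun i _ => (hcoord i).1,
    integral_const_mul]
  simp [hcoord]

theorem hardy_regularized {N : ℕ} (hN : 3 ≤ N) {w : Euc N → ℝ} (hw : Differentiable ℝ w)
    (h2w : HasCompactSupport w) (hint : Integrable fun x => ‖fderiv ℝ w x‖ ^ 2)
    {ε : ℝ} (hε : 0 < ε) :
    (((N : ℝ) - 2) / 2) ^ 2 * ∫ x, w x ^ 2 / (‖x‖ ^ 2 + ε) ≤ ∫ x, ‖fderiv ℝ w x‖ ^ 2 := by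
  have hN' : (3 : ℝ) ≤ N := by exact_mod_cast hN
  set a : ℝ := ((N : ℝ) - 2) / 2 with ha
  have ha0 : 0 < a := by rw [ha]; linarith
  have hpos : ∀ x : Euc N, 0 < ‖x‖ ^ 2 + ε := fun x => by positivity
  have hg : ContDiff ℝ 1 fun x : Euc N => (‖x‖ ^ 2 + ε)⁻¹ :=
    ((contDiff_norm_sq ℝ).add contDiff_const).inv fun x => (hpos x).ne'
  have hfg : ∀ x : Euc N, fderiv ℝ (fun x : Euc N => (‖x‖ ^ 2 + ε)⁻¹) x x =
      -(2 * ‖x‖ ^ 2) / (‖x‖ ^ 2 + ε) ^ 2 := by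
    intro x
    have h1 : HasFDerivAt (fun x : Euc N => ‖x‖ ^ 2 + ε) (2 • innerSL ℝ x) x :=
      (hasStrictFDerivAt_norm_sq x).hasFDerivAt.add_const ε
    have h2 := (hasDerivAt_inv (hpos x).ne').comp_hasFDerivAt x h1
    rw [show (fun x : Euc N => (‖x‖ ^ 2 + ε)⁻¹) = (fun t : ℝ => t⁻¹) ∘ fun x => ‖x‖ ^ 2 + ε from rfl,
      h2.fderiv]
    simp
    ring
  obtain ⟨i1, h1⟩ := integral_radial_divergence hw h2w
    (locallyIntegrable_fderiv_of_integrable_sq hint) hg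
  have hc : Continuous fun x => w x ^ 2 / (‖x‖ ^ 2 + ε) := by
    have := hw.continuous
    exact Continuous.div (by fun_prop) (by fun_prop) fun x => (hpos x).ne'
  have i2 : Integrable fun x => w x ^ 2 / (‖x‖ ^ 2 + ε) :=
    hc.integrable_of_hasCompactSupport
      (h2w.mono' fun x hx => subset_tsupport w fun h0 => hx (by simp [h0]))
  have key : ∀ x, a ^ 2 * (w x ^ 2 / (‖x‖ ^ 2 + ε)) - ‖fderiv ℝ w x‖ ^ 2 ≤
      a * (N * (w x ^ 2 * (‖x‖ ^ 2 + ε)⁻¹) + (2 * w x * (‖x‖ ^ 2 + ε)⁻¹ * fderiv ℝ w x x +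
        w x ^ 2 * fderiv ℝ (fun x : Euc N => (‖x‖ ^ 2 + ε)⁻¹) x x)) := by
    intro x
    rw [hfg]
    have hq := hpos x
    set D := fderiv ℝ w x
    set r := ‖x‖
    set q := r ^ 2 + ε with hqdef
    have hD : |D x| ≤ ‖D‖ * r := D.le_opNorm x
    have hN2 : (N : ℝ) = 2 * a + 2 := by rw [ha]; ring
    have hr : r ^ 2 ≤ q := by rw [hqdef]; linarith
    have e1 : 0 ≤ (w x / q) ^ 2 * (q - r ^ 2) := mul_nonneg (sq_nonneg _) (by linarith)
    have e2 : 0 ≤ (a * |w x / q| * r - ‖D‖) ^ 2 := sq_nonneg _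
    have e3 : -(|w x / q| * (‖D‖ * r)) ≤ w x / q * D x := by
      have := neg_abs_le (w x / q * D x)
      rw [abs_mul] at this
      have := mul_le_mul_of_nonneg_left hD (abs_nonneg (w x / q))
      linarith
    have e4 : |w x / q| ^ 2 = (w x / q) ^ 2 := sq_abs _
    have f1 : w x ^ 2 / q = (w x / q) ^ 2 * q := by field_simp
    have f2 : w x ^ 2 * q⁻¹ = (w x / q) ^ 2 * q := by field_simp
    have f3 : 2 * w x * q⁻¹ * D x = 2 * (w x / q * D x) := by field_simp
    have f4 : w x ^ 2 * (-(2 * r ^ 2) / q ^ 2) = -2 * ((w x / q) ^ 2 * r ^ 2) := by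
      field_simp
    rw [f1, f2, f3, f4, hN2]
    have e5 := mul_le_mul_of_nonneg_left e3 ha0.le
    have e6 := mul_nonneg (mul_nonneg ha0.le ha0.le) e1
    have e7 := mul_nonneg ha0.le e1
    have e8 : (a * |w x / q| * r - ‖D‖) ^ 2 = a ^ 2 * ((w x / q) ^ 2 * r ^ 2) -
        2 * (a * (|w x / q| * (‖D‖ * r))) + ‖D‖ ^ 2 := by rw [← e4]; ring
    rw [e8] at e2
    nlinarith
  have h3 := integral_mono ((i2.const_mul (a ^ 2)).sub hint) (i1.const_mul a) key
  rw [integral_const_mul, h1, mul_zero, integral_sub' (i2.const_mul _) hint,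
    integral_const_mul] at h3
  linarith

theorem hardy_of_differentiable {N : ℕ} (hN : 3 ≤ N) {w : Euc N → ℝ} (hw : Differentiable ℝ w)
    (h2w : HasCompactSupport w) (hint : Integrable fun x => ‖fderiv ℝ w x‖ ^ 2)
    (hh : Integrable fun x => w x ^ 2 / ‖x‖ ^ 2) :
    (((N : ℝ) - 2) / 2) ^ 2 * ∫ x, w x ^ 2 / ‖x‖ ^ 2 ≤ ∫ x, ‖fderiv ℝ w x‖ ^ 2 := by
  have : Nonempty (Fin N) := ⟨⟨0, by omega⟩⟩
  have hne : ∀ᵐ x : Euc N, x ≠ 0 := by simp [ae_iff]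
  have hlim : Filter.Tendsto (fun n : ℕ => ∫ x, w x ^ 2 / (‖x‖ ^ 2 + 1 / ((n : ℝ) + 1)))
      Filter.atTop (𝓝 (∫ x, w x ^ 2 / ‖x‖ ^ 2)) := by
    refine tendsto_integral_of_dominated_convergence (fun x => w x ^ 2 / ‖x‖ ^ 2)
      (fun n => ?_) hh (fun n => ?_) ?_
    · have := hw.continuous
      refine (Continuous.div (by fun_prop) (by fun_prop) fun x => ?_).aestronglyMeasurable
      positivity
    · filter_upwards [hne] with x hx
      have : 0 < ‖x‖ := norm_pos_iff.2 hx
      rw [Real.norm_of_nonneg (by positivity)]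
      gcongr
      have : 0 ≤ 1 / ((n : ℝ) + 1) := by positivity
      linarith
    · filter_upwards [hne] with x hx
      have : 0 < ‖x‖ := norm_pos_iff.2 hx
      refine Filter.Tendsto.div tendsto_const_nhds ?_ (by positivity)
      simpa using (tendsto_const_nhds (x := ‖x‖ ^ 2)).add
        (tendsto_one_div_add_atTop_nhds_zero_nat (𝕜 := ℝ))
  exact le_of_tendsto (hlim.const_mul _)
    (.of_forall fun n => hardy_regularized hN hw h2w hint (by positivity))

theorem norm_gradient_eq {N : ℕ} (v : Euc N → ℝ) (x : Euc N) :
    ‖gradient v x‖ = ‖fderiv ℝ v x‖ := by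
  rw [← toDual_gradient, LinearIsometryEquiv.norm_map]

theorem norm_smul_add_smul_innerSL_sq {E : Type*} [NormedAddCommGroup E] [InnerProductSpace ℝ E]
    [CompleteSpace E] (L : E →L[ℝ] ℝ) (x : E) (a b : ℝ) :
    ‖a • L + b • innerSL ℝ x‖ ^ 2 = a ^ 2 * ‖L‖ ^ 2 + 2 * a * b * L x + b ^ 2 * ‖x‖ ^ 2 := by
  obtain ⟨y, rfl⟩ := (InnerProductSpace.toDual ℝ E).surjective L
  have h : a • InnerProductSpace.toDual ℝ E y + b • innerSL ℝ x =
      InnerProductSpace.toDual ℝ E (a • y + b • x) := by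
    ext z
    simp
  rw [h, LinearIsometryEquiv.norm_map, LinearIsometryEquiv.norm_map, norm_add_sq_real,
    real_inner_smul_left, real_inner_smul_right, norm_smul, norm_smul, mul_pow, mul_pow,
    Real.norm_eq_abs, Real.norm_eq_abs, sq_abs, sq_abs, InnerProductSpace.toDual_apply_apply]
  ring

/-- The substitution `w = K^{1/2} v`. -/
def halfWeight {N : ℕ} (v : Euc N → ℝ) (x : Euc N) : ℝ := Real.exp (‖x‖ ^ 2 / 8) * v x

theorem Kw_eq_sq {N : ℕ} (x : Euc N) : Kw x = Real.exp (‖x‖ ^ 2 / 8) ^ 2 := by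
  rw [Kw, ← Real.exp_nat_mul]
  congr 1
  push_cast
  ring

theorem one_le_Kw {N : ℕ} (x : Euc N) : 1 ≤ Kw x := Real.one_le_exp (by positivity)

theorem Kw_pos {N : ℕ} (x : Euc N) : 0 < Kw x := Real.exp_pos _

theorem continuous_Kw {N : ℕ} : Continuous (Kw : Euc N → ℝ) := by
  unfold Kw
  fun_prop

theorem halfWeight_sq {N : ℕ} (v : Euc N → ℝ) (x : Euc N) :
    halfWeight v x ^ 2 = v x ^ 2 * Kw x := by
  rw [halfWeight, Kw_eq_sq]
  ring

theorem hasFDerivAt_halfWeight {N : ℕ} {v : Euc N → ℝ} (hv : Differentiable ℝ v) (x : Euc N) :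
    HasFDerivAt (halfWeight v) (Real.exp (‖x‖ ^ 2 / 8) • fderiv ℝ v x +
      (Real.exp (‖x‖ ^ 2 / 8) * v x / 4) • innerSL ℝ x) x := by
  have h1 : HasFDerivAt (fun x : Euc N => ‖x‖ ^ 2 / 8) ((8 : ℝ)⁻¹ • (2 • innerSL ℝ x)) x := by
    simpa only [div_eq_inv_mul] using (hasStrictFDerivAt_norm_sq x).hasFDerivAt.const_mul (8 : ℝ)⁻¹
  have h2 := h1.exp.mul (hv x).hasFDerivAt
  refine h2.congr_fderiv ?_
  ext y
  simp
  ring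

theorem norm_fderiv_halfWeight_sq {N : ℕ} {v : Euc N → ℝ} (hv : Differentiable ℝ v) (x : Euc N) :
    ‖fderiv ℝ (halfWeight v) x‖ ^ 2 = ‖fderiv ℝ v x‖ ^ 2 * Kw x +
      Kw x * v x / 2 * fderiv ℝ v x x + v x ^ 2 * ‖x‖ ^ 2 / 16 * Kw x := by
  rw [(hasFDerivAt_halfWeight hv x).fderiv, norm_smul_add_smul_innerSL_sq, Kw_eq_sq]
  ring

theorem norm_fderiv_sq_mul_Kw {N : ℕ} {v : Euc N → ℝ} (hv : Differentiable ℝ v) (x : Euc N) :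
    ‖fderiv ℝ v x‖ ^ 2 * Kw x = ‖fderiv ℝ (halfWeight v) x‖ ^ 2 + N / 4 * halfWeight v x ^ 2 +
      ‖x‖ ^ 2 / 16 * halfWeight v x ^ 2 - 1 / 4 * (N * halfWeight v x ^ 2 +
      2 * halfWeight v x * fderiv ℝ (halfWeight v) x x) := by
  have h : fderiv ℝ (halfWeight v) x x = Real.exp (‖x‖ ^ 2 / 8) * fderiv ℝ v x x +
      Real.exp (‖x‖ ^ 2 / 8) * v x / 4 * ‖x‖ ^ 2 := by
    rw [(hasFDerivAt_halfWeight hv x).fderiv]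
    simp
  rw [norm_fderiv_halfWeight_sq hv, h, halfWeight_sq, halfWeight, Kw_eq_sq]
  ring

theorem integrable_norm_fderiv_halfWeight_sq {N : ℕ} {v : Euc N → ℝ} (hv : Differentiable ℝ v)
    (h2v : HasCompactSupport v) (hint : Integrable fun x => ‖fderiv ℝ v x‖ ^ 2 * Kw x) :
    Integrable fun x => ‖fderiv ℝ (halfWeight v) x‖ ^ 2 := by
  have h1 : Integrable fun x => ‖fderiv ℝ v x‖ ^ 2 := by
    refine hint.mono' ((measurable_fderiv ℝ v).norm.pow_const 2).aestronglyMeasurable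
      (.of_forall fun x => ?_)
    rw [Real.norm_of_nonneg (by positivity)]
    exact le_mul_of_one_le_right (by positivity) (one_le_Kw x)
  have hvc := hv.continuous
  have hK := continuous_Kw (N := N)
  have h3 : Integrable fun x => v x ^ 2 * ‖x‖ ^ 2 / 16 * Kw x :=
    Continuous.integrable_of_hasCompactSupport (by fun_prop)
      (h2v.mono' fun x hx => subset_tsupport v fun h0 => hx (by simp [h0]))
  have h2 : ∀ i : Fin N, Integrable fun x => Kw x * v x / 2 * x i *
      fderiv ℝ v x (EuclideanSpace.single i 1) := by
    intro i
    have h := (locallyIntegrable_fderiv_of_integrable_sq h1).integrable_smul_left_of_hasCompactSupport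
      (g := fun x : Euc N => Kw x * v x / 2 * x i) (by fun_prop)
      (h2v.mono' fun x hx => subset_tsupport v fun h0 => hx (by simp [h0]))
    exact h.apply_continuousLinearMap (EuclideanSpace.single i 1)
  refine ((hint.add (integrable_finsetSum Finset.univ fun i _ => h2 i)).add h3).congr
    (.of_forall fun x => ?_)
  have hx := congrArg (fderiv ℝ v x) ((EuclideanSpace.basisFun (Fin N) ℝ).sum_repr x)
  simp only [Pi.add_apply]
  rw [norm_fderiv_halfWeight_sq hv, ← hx]
  simp [Finset.mul_sum, mul_assoc]

theorem MemX.integrable_Afun {N : ℕ} {v : Euc N → ℝ} (hv : MemX v) (μ : ℝ) :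
    Integrable fun x => (‖gradient v x‖ ^ 2 - μ * v x ^ 2 / ‖x‖ ^ 2 -
      ((N : ℝ) - 2) / 4 * v x ^ 2) * Kw x := by
  refine ((hv.int_grad.sub (hv.int_hardy.const_mul μ)).sub
    (hv.int_sq.const_mul (((N : ℝ) - 2) / 4))).congr (.of_forall fun x => ?_)
  simp only [Pi.sub_apply]
  ring

theorem exists_coercive_of_hasCompactSupport {N : ℕ} (hN : 3 ≤ N) :
    ∃ c : ℝ, 0 < c ∧ ∀ μ ∈ Icc (0 : ℝ) (((N : ℝ) - 2) ^ 2 / 8), ∀ v : Euc N → ℝ, MemX v →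
      HasCompactSupport v → c * Bfun v ^ (2 / twoStar N) ≤ Afun μ v := by
  have hN' : (3 : ℝ) ≤ N := by exact_mod_cast hN
  have hs := twoStar_gt_two hN
  obtain ⟨S, hS, hsob⟩ := sobolev_of_differentiable hN
  refine ⟨S / 2, by positivity, fun μ hμ v hv h2v => ?_⟩
  set w := halfWeight v with hw_def
  have hwd : Differentiable ℝ w := fun x => (hasFDerivAt_halfWeight hv.diff x).differentiableAt
  have h2w : HasCompactSupport w := h2v.mul_left
  have hgv : Integrable fun x => ‖fderiv ℝ v x‖ ^ 2 * Kw x := by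
    simpa only [norm_gradient_eq] using hv.int_grad
  have hgw : Integrable fun x => ‖fderiv ℝ w x‖ ^ 2 :=
    integrable_norm_fderiv_halfWeight_sq hv.diff h2v hgv
  have hhw : Integrable fun x => w x ^ 2 / ‖x‖ ^ 2 := by
    refine hv.int_hardy.congr (.of_forall fun x => ?_)
    simp only [hw_def, halfWeight_sq]
    ring
  have hsobw := hsob w hwd h2w hgw
  have hhardy := hardy_of_differentiable hN hwd h2w hgw hhw
  obtain ⟨idiv, hdiv⟩ := integral_radial_divergence (g := fun _ => (1 : ℝ)) hwd h2w
    (locallyIntegrable_fderiv_of_integrable_sq hgw) contDiff_const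
  simp only [mul_one, fderiv_fun_const, Pi.zero_apply, zero_apply, mul_zero,
    add_zero] at idiv hdiv
  have hBw : Bfun v ≤ ∫ x, |w x| ^ twoStar N := by
    have hcont : Continuous fun x => |w x| ^ twoStar N :=
      hwd.continuous.abs.rpow_const fun _ => Or.inr (by linarith)
    refine integral_mono hv.int_crit (hcont.integrable_of_hasCompactSupport
      (h2w.comp_left (g := fun t : ℝ => |t| ^ twoStar N) (by
        simp [Real.zero_rpow (show twoStar N ≠ 0 by linarith)]))) fun x => ?_
    simp only [hw_def, halfWeight, abs_mul, Real.abs_exp]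
    rw [Real.mul_rpow (by positivity) (abs_nonneg _), mul_comm, ← Real.exp_mul, Kw]
    gcongr
    nlinarith [sq_nonneg ‖x‖]
  have hA : (∫ x, ‖fderiv ℝ w x‖ ^ 2) - μ * ∫ x, w x ^ 2 / ‖x‖ ^ 2 ≤ Afun μ v := by
    have i2 : Integrable fun x => ‖fderiv ℝ w x‖ ^ 2 - μ * (w x ^ 2 / ‖x‖ ^ 2) :=
      hgw.sub (hhw.const_mul μ)
    have hint : Integrable fun x => (‖fderiv ℝ w x‖ ^ 2 - μ * (w x ^ 2 / ‖x‖ ^ 2)) -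
        1 / 4 * (N * w x ^ 2 + 2 * w x * fderiv ℝ w x x) :=
      i2.sub (idiv.const_mul _)
    have heq : ∫ x, ((‖fderiv ℝ w x‖ ^ 2 - μ * (w x ^ 2 / ‖x‖ ^ 2)) -
        1 / 4 * (N * w x ^ 2 + 2 * w x * fderiv ℝ w x x)) =
        (∫ x, ‖fderiv ℝ w x‖ ^ 2) - μ * ∫ x, w x ^ 2 / ‖x‖ ^ 2 := by
      rw [integral_sub i2 (idiv.const_mul _), integral_const_mul, hdiv,
        mul_zero, sub_zero, integral_sub hgw (hhw.const_mul μ), integral_const_mul]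
    rw [← heq]
    refine integral_mono hint (hv.integrable_Afun μ) fun x => ?_
    have e1 := norm_fderiv_sq_mul_Kw hv.diff x
    have e2 : μ * v x ^ 2 / ‖x‖ ^ 2 * Kw x = μ * (w x ^ 2 / ‖x‖ ^ 2) := by
      rw [hw_def, halfWeight_sq]
      ring
    have e3 : ((N : ℝ) - 2) / 4 * v x ^ 2 * Kw x = ((N : ℝ) - 2) / 4 * w x ^ 2 := by
      rw [hw_def, halfWeight_sq]
      ring
    have e4 : 0 ≤ ‖x‖ ^ 2 / 16 * w x ^ 2 := by positivity
    simp only [norm_gradient_eq, sub_mul, e2, e3]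
    rw [e1, ← hw_def]
    nlinarith [sq_nonneg (w x)]
  have hH0 : 0 ≤ ∫ x, w x ^ 2 / ‖x‖ ^ 2 := integral_nonneg fun x => by positivity
  have hB0 : 0 ≤ Bfun v := integral_nonneg fun x => by have := Kw_pos x; positivity
  have hpow : Bfun v ^ (2 / twoStar N) ≤ (∫ x, |w x| ^ twoStar N) ^ (2 / twoStar N) := by
    gcongr
  have h1 := mul_le_mul_of_nonneg_left hpow hS.le
  have h2 := mul_le_mul_of_nonneg_right hμ.2 hH0
  linarith

theorem exists_cutoff_seq (N : ℕ) :
    ∃ (M : ℝ) (χ : ℕ → Euc N → ℝ), ∀ n, ContDiff ℝ 1 (χ n) ∧ HasCompactSupport (χ n) ∧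
      (∀ x, |χ n x| ≤ 1) ∧ (∀ x, ‖fderiv ℝ (χ n) x‖ ≤ M) ∧ ∀ x, ‖x‖ < n + 1 → χ n x = 1 := by
  let f : ContDiffBump (0 : Euc N) := ⟨1, 2, one_pos, one_lt_two⟩
  have hf : ContDiff ℝ 1 f := f.contDiff
  obtain ⟨M, hM⟩ := (f.hasCompactSupport.fderiv ℝ).exists_bound_of_continuous
    (hf.continuous_fderiv one_ne_zero)
  refine ⟨M, fun n x => f (((n : ℝ) + 1)⁻¹ • x), fun n => ⟨?_, ?_, fun x => ?_, fun x => ?_,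
    fun x hx => ?_⟩⟩
  · exact hf.comp (contDiff_const_smul _)
  · exact f.hasCompactSupport.comp_smul (by positivity)
  · rw [abs_of_nonneg f.nonneg]
    exact f.le_one
  · have hM0 : 0 ≤ M := (norm_nonneg _).trans (hM 0)
    have h1 : ((n : ℝ) + 1)⁻¹ ≤ 1 := inv_le_one_of_one_le₀ (by linarith [n.cast_nonneg (α := ℝ)])
    rw [fderiv_comp_smul, norm_smul, Real.norm_of_nonneg (by positivity)]
    exact (mul_le_mul h1 (hM _) (norm_nonneg _) zero_le_one).trans_eq (one_mul M)
  · refine f.one_of_mem_closedBall ?_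
    rw [mem_closedBall_zero_iff, norm_smul, Real.norm_of_nonneg (by positivity),
      inv_mul_le_iff₀ (by positivity)]
    simpa [f] using hx.le

theorem norm_gradient_mul_sq_le {N : ℕ} {v χ : Euc N → ℝ} {M : ℝ} (hv : Differentiable ℝ v)
    (hχ : Differentiable ℝ χ) {x : Euc N} (hle : |χ x| ≤ 1) (hM : ‖fderiv ℝ χ x‖ ≤ M) :
    ‖gradient (fun x => χ x * v x) x‖ ^ 2 ≤ 2 * ‖gradient v x‖ ^ 2 + 2 * M ^ 2 * v x ^ 2 := by
  rw [norm_gradient_eq, norm_gradient_eq, fderiv_fun_mul (hχ x) (hv x)]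
  have h : ‖χ x • fderiv ℝ v x + v x • fderiv ℝ χ x‖ ≤ ‖fderiv ℝ v x‖ + M * |v x| := by
    refine (norm_add_le _ _).trans (add_le_add ?_ ?_)
    · rw [norm_smul, Real.norm_eq_abs]
      exact mul_le_of_le_one_left (norm_nonneg _) hle
    · rw [norm_smul, Real.norm_eq_abs, mul_comm]
      gcongr
  have h2 := pow_le_pow_left₀ (norm_nonneg _) h 2
  have h3 : (M * |v x|) ^ 2 = M ^ 2 * v x ^ 2 := by rw [mul_pow, sq_abs]
  nlinarith [sq_nonneg (‖fderiv ℝ v x‖ - M * |v x|)]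

theorem measurable_gradient {N : ℕ} (v : Euc N → ℝ) : Measurable (gradient v) :=
  (InnerProductSpace.toDual ℝ (Euc N)).symm.continuous.measurable.comp (measurable_fderiv ℝ v)

theorem sq_mul_le_sq {a b : ℝ} (h : |a| ≤ 1) : (a * b) ^ 2 ≤ b ^ 2 := by
  rw [mul_pow]
  exact mul_le_of_le_one_left (sq_nonneg b) ((sq_le_one_iff_abs_le_one a).2 h)

theorem abs_mul_rpow_le {a b s : ℝ} (h : |a| ≤ 1) (hs : 0 ≤ s) : |a * b| ^ s ≤ |b| ^ s := by
  rw [abs_mul]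
  exact Real.rpow_le_rpow (by positivity) (mul_le_of_le_one_left (abs_nonneg b) h) hs

theorem MemX.mul_cutoff {N : ℕ} (hN : 3 ≤ N) {v χ : Euc N → ℝ} {M : ℝ} (hv : MemX v)
    (hχ : Differentiable ℝ χ) (hle : ∀ x, |χ x| ≤ 1) (hM : ∀ x, ‖fderiv ℝ χ x‖ ≤ M) :
    MemX fun x => χ x * v x := by
  have hs := twoStar_gt_two hN
  have hd : Differentiable ℝ fun x => χ x * v x := hχ.mul hv.diff
  have hm := hd.continuous.measurable
  have hK := (continuous_Kw (N := N)).measurable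
  refine ⟨hd, ?_, ?_, ?_, ?_⟩
  · refine ((hv.int_grad.const_mul 2).add (hv.int_sq.const_mul (2 * M ^ 2))).mono'
      (((measurable_gradient _).norm.pow_const 2).mul hK).aestronglyMeasurable
      (.of_forall fun x => ?_)
    have hKx := Kw_pos x
    rw [Real.norm_of_nonneg (by positivity)]
    refine (mul_le_mul_of_nonneg_right
      (norm_gradient_mul_sq_le hv.diff hχ (hle x) (hM x)) hKx.le).trans_eq ?_
    simp only [Pi.add_apply]
    ring
  · refine hv.int_sq.mono' ((hm.pow_const 2).mul hK).aestronglyMeasurable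
      (.of_forall fun x => ?_)
    have hKx := Kw_pos x
    rw [Real.norm_of_nonneg (by positivity)]
    exact mul_le_mul_of_nonneg_right (sq_mul_le_sq (hle x)) hKx.le
  · refine hv.int_hardy.mono' (((hm.pow_const 2).div (measurable_norm.pow_const 2)).mul
      hK).aestronglyMeasurable (.of_forall fun x => ?_)
    have hKx := Kw_pos x
    rw [Real.norm_of_nonneg (by positivity)]
    have := sq_mul_le_sq (b := v x) (hle x)
    gcongr
  · refine hv.int_crit.mono' ((hm.abs.pow_const _).mul hK).aestronglyMeasurable
      (.of_forall fun x => ?_)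
    have hKx := Kw_pos x
    rw [Real.norm_of_nonneg (by positivity)]
    exact mul_le_mul_of_nonneg_right (abs_mul_rpow_le (hle x) (by linarith)) hKx.le

theorem exists_coercive {N : ℕ} (hN : 3 ≤ N) :
    ∃ c : ℝ, 0 < c ∧ ∀ μ ∈ Icc (0 : ℝ) (((N : ℝ) - 2) ^ 2 / 8), ∀ v : Euc N → ℝ, MemX v →
      c * Bfun v ^ (2 / twoStar N) ≤ Afun μ v := by
  have hs := twoStar_gt_two hN
  have hN' : (3 : ℝ) ≤ N := by exact_mod_cast hN
  obtain ⟨c, hc, hcoer⟩ := exists_coercive_of_hasCompactSupport hN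
  refine ⟨c, hc, fun μ hμ v hv => ?_⟩
  obtain ⟨M, χ, hχ⟩ := exists_cutoff_seq N
  have hχd : ∀ n, Differentiable ℝ (χ n) := fun n => (hχ n).1.differentiable one_ne_zero
  have hle : ∀ n x, |χ n x| ≤ 1 := fun n => (hχ n).2.2.1
  have hM : ∀ n x, ‖fderiv ℝ (χ n) x‖ ≤ M := fun n => (hχ n).2.2.2.1
  let u : ℕ → Euc N → ℝ := fun n x => χ n x * v x
  have hu : ∀ n, MemX (u n) := fun n => hv.mul_cutoff hN (hχd n) (hle n) (hM n)
  have hev : ∀ x, ∀ᶠ n in Filter.atTop, u n =ᶠ[𝓝 x] v := by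
    intro x
    obtain ⟨n₀, hn₀⟩ := exists_nat_ge ‖x‖
    filter_upwards [Filter.eventually_ge_atTop n₀] with n hn
    have hn' : ‖x‖ < (n : ℝ) + 1 := by
      have : (n₀ : ℝ) ≤ n := by exact_mod_cast hn
      linarith
    filter_upwards [continuous_norm.continuousAt.eventually_lt_const hn'] with y hy
    simp only [u]
    rw [(hχ n).2.2.2.2 y hy, one_mul]
  have hB : Filter.Tendsto (fun n => Bfun (u n)) Filter.atTop (𝓝 (Bfun v)) := by
    refine tendsto_integral_of_dominated_convergence _
      (fun n => (hu n).int_crit.aestronglyMeasurable) hv.int_crit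
      (fun n => .of_forall fun x => ?_) (.of_forall fun x => ?_)
    · have hKx := Kw_pos x
      rw [Real.norm_of_nonneg (by positivity)]
      exact mul_le_mul_of_nonneg_right (abs_mul_rpow_le (hle n x) (by linarith)) hKx.le
    · refine tendsto_const_nhds.congr' ?_
      filter_upwards [hev x] with n hn
      rw [hn.eq_of_nhds]
  have hA : Filter.Tendsto (fun n => Afun μ (u n)) Filter.atTop (𝓝 (Afun μ v)) := by
    refine tendsto_integral_of_dominated_convergence
      (fun x => 2 * (‖gradient v x‖ ^ 2 * Kw x) + 2 * M ^ 2 * (v x ^ 2 * Kw x) +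
        μ * (v x ^ 2 / ‖x‖ ^ 2 * Kw x) + ((N : ℝ) - 2) / 4 * (v x ^ 2 * Kw x))
      (fun n => ((hu n).integrable_Afun μ).aestronglyMeasurable)
      ((((hv.int_grad.const_mul _).add (hv.int_sq.const_mul _)).add
        (hv.int_hardy.const_mul _)).add (hv.int_sq.const_mul _))
      (fun n => .of_forall fun x => ?_) (.of_forall fun x => ?_)
    · have hKx := Kw_pos x
      have hμ0 := hμ.1
      have e1 : ‖gradient (u n) x‖ ^ 2 ≤ _ :=
        norm_gradient_mul_sq_le hv.diff (hχd n) (hle n x) (hM n x)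
      have e2 : u n x ^ 2 ≤ v x ^ 2 := sq_mul_le_sq (hle n x)
      have e3 : μ * u n x ^ 2 / ‖x‖ ^ 2 ≤ μ * v x ^ 2 / ‖x‖ ^ 2 := by gcongr
      have e4 : 0 ≤ μ * u n x ^ 2 / ‖x‖ ^ 2 := by positivity
      have hβ : 0 ≤ ((N : ℝ) - 2) / 4 := by linarith
      have e5 := mul_le_mul_of_nonneg_left e2 hβ
      have e6 : 0 ≤ ((N : ℝ) - 2) / 4 * u n x ^ 2 := by positivity
      have e7 : 0 ≤ 2 * M ^ 2 * v x ^ 2 := by positivity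
      rw [norm_mul, Real.norm_of_nonneg hKx.le]
      have h : ‖‖gradient (u n) x‖ ^ 2 - μ * u n x ^ 2 / ‖x‖ ^ 2 -
          ((N : ℝ) - 2) / 4 * u n x ^ 2‖ ≤ 2 * ‖gradient v x‖ ^ 2 + 2 * M ^ 2 * v x ^ 2 +
          μ * v x ^ 2 / ‖x‖ ^ 2 + ((N : ℝ) - 2) / 4 * v x ^ 2 := by
        rw [Real.norm_eq_abs, abs_le]
        constructor <;> nlinarith [sq_nonneg ‖gradient (u n) x‖, sq_nonneg ‖gradient v x‖]
      refine (mul_le_mul_of_nonneg_right h hKx.le).trans_eq ?_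
      ring
    · refine tendsto_const_nhds.congr' ?_
      filter_upwards [hev x] with n hn
      rw [hn.eq_of_nhds, hn.gradient_eq]
  refine le_of_tendsto_of_tendsto'
    ((hB.rpow_const (.inr (show 0 ≤ 2 / twoStar N by positivity))).const_mul c) hA fun n =>
    hcoer μ hμ (u n) (hu n) (hχ n).2.1.mul_right

theorem norm_gradient_const_mul_sq {N : ℕ} {v : Euc N → ℝ} (hv : Differentiable ℝ v) (t : ℝ)
    (x : Euc N) : ‖gradient (fun x => t * v x) x‖ ^ 2 = t ^ 2 * ‖gradient v x‖ ^ 2 := by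
  rw [norm_gradient_eq, norm_gradient_eq, fderiv_const_mul (hv x), norm_smul, mul_pow,
    Real.norm_eq_abs, sq_abs]

theorem MemX.const_mul {N : ℕ} {v : Euc N → ℝ} (hv : MemX v) (t : ℝ) :
    MemX fun x => t * v x := by
  refine ⟨hv.diff.const_mul t, ?_, ?_, ?_, ?_⟩
  · refine (hv.int_grad.const_mul (t ^ 2)).congr (.of_forall fun x => ?_)
    simp only [norm_gradient_const_mul_sq hv.diff]
    ring
  · refine (hv.int_sq.const_mul (t ^ 2)).congr (.of_forall fun x => ?_)
    simp only
    ring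
  · refine (hv.int_hardy.const_mul (t ^ 2)).congr (.of_forall fun x => ?_)
    simp only
    ring
  · refine (hv.int_crit.const_mul (|t| ^ twoStar N)).congr (.of_forall fun x => ?_)
    simp only [abs_mul]
    rw [Real.mul_rpow (abs_nonneg _) (abs_nonneg _), mul_assoc]

theorem Afun_const_mul {N : ℕ} {v : Euc N → ℝ} (hv : Differentiable ℝ v) (μ t : ℝ) :
    Afun μ (fun x => t * v x) = t ^ 2 * Afun μ v := by
  rw [Afun, Afun, ← integral_const_mul]
  congr 1
  funext x
  rw [norm_gradient_const_mul_sq hv]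
  ring

theorem gradNormSq_const_mul {N : ℕ} {v : Euc N → ℝ} (hv : Differentiable ℝ v) (t : ℝ) :
    gradNormSq (fun x => t * v x) = t ^ 2 * gradNormSq v := by
  rw [gradNormSq, gradNormSq, ← integral_const_mul]
  congr 1
  funext x
  rw [norm_gradient_const_mul_sq hv, mul_assoc]

theorem Bfun_const_mul {N : ℕ} (v : Euc N → ℝ) {t : ℝ} (ht : 0 ≤ t) :
    Bfun (fun x => t * v x) = t ^ twoStar N * Bfun v := by
  rw [Bfun, Bfun, ← integral_const_mul]
  congr 1
  funext x
  rw [abs_mul, abs_of_nonneg ht, Real.mul_rpow ht (abs_nonneg _), mul_assoc]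

theorem Bfun_nonneg {N : ℕ} (v : Euc N → ℝ) : 0 ≤ Bfun v :=
  integral_nonneg fun x => mul_nonneg (by positivity) (Kw_pos x).le

theorem eq_zero_of_Bfun_eq_zero {N : ℕ} (hN : 3 ≤ N) {v : Euc N → ℝ} (hv : MemX v)
    (h : Bfun v = 0) : v = 0 := by
  have hs := twoStar_gt_two hN
  have hcont : Continuous fun x => |v x| ^ twoStar N * Kw x :=
    (hv.diff.continuous.abs.rpow_const fun _ => Or.inr (by linarith)).mul continuous_Kw
  rw [Bfun, integral_eq_zero_iff_of_nonneg (fun x => mul_nonneg (by positivity) (Kw_pos x).le)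
    hv.int_crit] at h
  have h0 := (hcont.ae_eq_iff_eq volume continuous_const).1 h
  funext x
  have hx := congrFun h0 x
  rcases mul_eq_zero.1 hx with hx | hx
  · exact abs_eq_zero.1 ((Real.rpow_eq_zero (abs_nonneg _) (by linarith)).1 hx)
  · exact absurd hx (Kw_pos x).ne'

/-- The modified Nehari manifold. -/
def nehari (N : ℕ) (μ δ : ℝ) : Set (Euc N → ℝ) :=
  {v | MemX v ∧ DKd μ δ v = 0 ∧ gradNormSq v ≠ 0}

theorem Bfun_pos_of_mem_nehari {N : ℕ} (hN : 3 ≤ N) {μ δ : ℝ} {v : Euc N → ℝ}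
    (hv : v ∈ nehari N μ δ) : 0 < Bfun v := by
  refine (Bfun_nonneg v).lt_of_ne' fun h => hv.2.2 ?_
  rw [eq_zero_of_Bfun_eq_zero hN hv.1 h]
  simp [gradNormSq, norm_gradient_eq]

theorem const_mul_mem_nehari {N : ℕ} (hN : 3 ≤ N) {μ δ δ' : ℝ} (hδ : 0 < δ) (hδ' : 0 < δ')
    {v : Euc N → ℝ} (hv : v ∈ nehari N μ δ) :
    (fun x => (δ' / δ) ^ (((N : ℝ) - 2) / 4) * v x) ∈ nehari N μ δ' ∧
    Afun μ (fun x => (δ' / δ) ^ (((N : ℝ) - 2) / 4) * v x) =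
      (δ' / δ) ^ (((N : ℝ) - 2) / 2) * Afun μ v := by
  have hN' : (3 : ℝ) ≤ N := by exact_mod_cast hN
  have hr : 0 < δ' / δ := by positivity
  have h2 : ((δ' / δ) ^ (((N : ℝ) - 2) / 4)) ^ 2 = (δ' / δ) ^ (((N : ℝ) - 2) / 2) := by
    rw [← Real.rpow_mul_natCast hr.le]
    congr 1
    push_cast
    ring
  have hs : ((δ' / δ) ^ (((N : ℝ) - 2) / 4)) ^ twoStar N =
      (δ' / δ) ^ (((N : ℝ) - 2) / 2) * (δ' / δ) := by
    rw [← Real.rpow_mul hr.le, ← Real.rpow_add_one hr.ne', twoStar]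
    congr 1
    have : (N : ℝ) - 2 ≠ 0 := by linarith
    field_simp
    ring
  have hA : Afun μ (fun x => (δ' / δ) ^ (((N : ℝ) - 2) / 4) * v x) =
      (δ' / δ) ^ (((N : ℝ) - 2) / 2) * Afun μ v := by
    rw [Afun_const_mul hv.1.diff, h2]
  refine ⟨⟨hv.1.const_mul _, ?_, ?_⟩, hA⟩
  · have hD : Bfun v = δ * Afun μ v := (sub_eq_zero.1 hv.2.1).symm
    rw [DKd, hA, Bfun_const_mul _ (by positivity), hs, hD]
    field_simp
    ring
  · rw [gradNormSq_const_mul hv.1.diff]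
    have := hv.2.2
    positivity

/-- The factor by which the depth at `δ` differs from the infimum of `A` over the Nehari
manifold. -/
def depthFactor (N : ℕ) (δ : ℝ) : ℝ := δ ^ (((N : ℝ) - 2) / 2) * (1 / 2 - δ / twoStar N)

theorem EKf_eq_of_mem_nehari {N : ℕ} {μ δ : ℝ} {v : Euc N → ℝ} (hv : v ∈ nehari N μ δ) :
    EKf μ v = (1 / 2 - δ / twoStar N) * Afun μ v := by
  have hD : Bfun v = δ * Afun μ v := (sub_eq_zero.1 hv.2.1).symm
  rw [EKf, hD]
  ring

theorem ddepth_eq {N : ℕ} (hN : 3 ≤ N) (μ : ℝ) {δ : ℝ} (hδ : 0 < δ) (hδ' : δ < twoStar N / 2) :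
    ddepth N μ δ = depthFactor N δ * sInf (Afun μ '' nehari N μ 1) := by
  have hs := twoStar_gt_two hN
  have hfac : 0 ≤ depthFactor N δ := by
    refine mul_nonneg (by positivity) ?_
    rw [sub_nonneg, div_le_div_iff₀ (by linarith) two_pos]
    linarith
  have hset : {e | ∃ v : Euc N → ℝ, MemX v ∧ DKd μ δ v = 0 ∧ gradNormSq v ≠ 0 ∧ e = EKf μ v} =
      depthFactor N δ • (Afun μ '' nehari N μ 1) := by
    ext e
    simp only [Set.mem_ofPred_eq, Set.mem_smul_set, Set.exists_mem_image, smul_eq_mul]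
    constructor
    · rintro ⟨v, hv1, hv2, hv3, rfl⟩
      have hv : v ∈ nehari N μ δ := ⟨hv1, hv2, hv3⟩
      obtain ⟨hu, hA⟩ := const_mul_mem_nehari hN hδ one_pos hv
      refine ⟨_, hu, ?_⟩
      rw [hA, EKf_eq_of_mem_nehari hv, depthFactor, one_div δ, Real.inv_rpow hδ.le]
      field_simp
    · rintro ⟨v, hv, rfl⟩
      obtain ⟨hu, hA⟩ := const_mul_mem_nehari hN one_pos hδ hv
      refine ⟨_, hu.1, hu.2.1, hu.2.2, ?_⟩
      rw [EKf_eq_of_mem_nehari hu, hA, depthFactor, div_one]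
      ring
  rw [ddepth, hset, Real.sInf_smul_of_nonneg hfac, smul_eq_mul]

theorem exists_memX_Bfun_pos {N : ℕ} (hN : 3 ≤ N) : ∃ v : Euc N → ℝ, MemX v ∧ 0 < Bfun v := by
  have hs := twoStar_gt_two hN
  let c : Euc N := EuclideanSpace.single ⟨0, by omega⟩ 1
  have hc : ‖c‖ = 1 := by simp [c]
  let f : ContDiffBump c := ⟨1 / 4, 1 / 2, by norm_num, by norm_num⟩
  have hf : ContDiff ℝ 1 f := f.contDiff
  have hsupp := f.hasCompactSupport
  have hfd := hf.differentiable one_ne_zero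
  have hfc := f.continuous
  have hKc := continuous_Kw (N := N)
  have hf0 : ∀ x, ‖x‖ ≤ 1 / 2 → f x = 0 := fun x hx => f.zero_of_le_dist (by
    have := norm_sub_norm_le c x
    rw [dist_comm, dist_eq_norm]
    change 1 / 2 ≤ ‖c - x‖
    linarith)
  have isq : Integrable fun x => f x ^ 2 * Kw x :=
    Continuous.integrable_of_hasCompactSupport (by fun_prop)
      (hsupp.mono' fun x hx => subset_tsupport f fun h0 => hx (by simp [h0]))
  have hcrit : Continuous fun x => |f x| ^ twoStar N * Kw x :=
    (hfc.abs.rpow_const fun _ => Or.inr (by linarith)).mul hKc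
  have hcsupp : HasCompactSupport fun x => |f x| ^ twoStar N * Kw x :=
    hsupp.mono' fun x hx => subset_tsupport f fun h0 => hx (by
      simp [h0, Real.zero_rpow (show twoStar N ≠ 0 by linarith)])
  refine ⟨f, ⟨hfd, ?_, isq, ?_, hcrit.integrable_of_hasCompactSupport hcsupp⟩, ?_⟩
  · simp only [norm_gradient_eq]
    have := hf.continuous_fderiv one_ne_zero
    exact Continuous.integrable_of_hasCompactSupport (by fun_prop)
      ((hsupp.fderiv ℝ).mono' fun x hx => subset_tsupport _ fun h0 => hx (by simp [h0]))
  · refine (isq.const_mul 4).mono' (((hfc.measurable.pow_const 2).div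
      (measurable_norm.pow_const 2)).mul hKc.measurable).aestronglyMeasurable
      (.of_forall fun x => ?_)
    have hKx := Kw_pos x
    rw [Real.norm_of_nonneg (by positivity), ← mul_assoc]
    refine mul_le_mul_of_nonneg_right ?_ hKx.le
    rcases le_or_gt ‖x‖ (1 / 2) with hx | hx
    · simp [hf0 x hx]
    · rw [div_le_iff₀ (by positivity)]
      have : 1 ≤ 4 * ‖x‖ ^ 2 := by nlinarith
      nlinarith [sq_nonneg (f x)]
  · refine hcrit.integral_pos_of_hasCompactSupport_nonneg_nonzero hcsupp
      (fun x => mul_nonneg (by positivity) (Kw_pos x).le) (x := c) ?_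
    rw [f.one_of_mem_closedBall (Metric.mem_closedBall_self f.rIn_pos.le)]
    simpa using (Kw_pos c).ne'

theorem Afun_le_gradNormSq {N : ℕ} (hN : 3 ≤ N) {μ : ℝ} (hμ : 0 ≤ μ) {v : Euc N → ℝ}
    (hv : MemX v) : Afun μ v ≤ gradNormSq v := by
  have hN' : (3 : ℝ) ≤ N := by exact_mod_cast hN
  refine integral_mono (hv.integrable_Afun μ) hv.int_grad fun x => ?_
  have hβ : 0 ≤ ((N : ℝ) - 2) / 4 * v x ^ 2 := mul_nonneg (by linarith) (sq_nonneg _)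
  have : 0 ≤ μ * v x ^ 2 / ‖x‖ ^ 2 := by positivity
  refine mul_le_mul_of_nonneg_right ?_ (Kw_pos x).le
  linarith

theorem sInf_Afun_nehari_pos {N : ℕ} (hN : 3 ≤ N) {μ : ℝ}
    (hμ : μ ∈ Icc (0 : ℝ) (((N : ℝ) - 2) ^ 2 / 8)) : 0 < sInf (Afun μ '' nehari N μ 1) := by
  have hs := twoStar_gt_two hN
  obtain ⟨c, hc, hcoer⟩ := exists_coercive hN
  have he : 0 < 1 - 2 / twoStar N := by
    rw [sub_pos, div_lt_one (by linarith)]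
    exact hs
  have hne : (Afun μ '' nehari N μ 1).Nonempty := by
    obtain ⟨v, hv, hB⟩ := exists_memX_Bfun_pos hN
    have hA : 0 < Afun μ v := lt_of_lt_of_le (by positivity) (hcoer μ hμ v hv)
    have hmem : v ∈ nehari N μ (Bfun v / Afun μ v) :=
      ⟨hv, by rw [DKd, div_mul_cancel₀ _ hA.ne', sub_self],
        (hA.trans_le (Afun_le_gradNormSq hN hμ.1 hv)).ne'⟩
    exact ⟨_, Set.mem_image_of_mem _
      (const_mul_mem_nehari hN (div_pos hB hA) one_pos hmem).1⟩
  refine lt_of_lt_of_le (show 0 < c ^ (1 - 2 / twoStar N)⁻¹ by positivity)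
    (le_csInf hne ?_)
  rintro _ ⟨v, hv, rfl⟩
  have hB := Bfun_pos_of_mem_nehari hN hv
  have hAB : Bfun v = Afun μ v := by
    have := sub_eq_zero.1 hv.2.1
    linarith
  have h := hcoer μ hμ v hv.1
  rw [← hAB, ← le_div_iff₀ (by positivity)] at h
  rw [← hAB, Real.rpow_inv_le_iff_of_pos hc.le hB.le he, Real.rpow_sub hB, Real.rpow_one]
  exact h

theorem hasDerivAt_depthFactor {N : ℕ} (hN : 3 ≤ N) {δ : ℝ} (hδ : 0 < δ) :
    HasDerivAt (depthFactor N)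
      (δ ^ (((N : ℝ) - 2) / 2 - 1) * (((N : ℝ) - 2) / 4) * (1 - δ)) δ := by
  have hN' : (3 : ℝ) ≤ N := by exact_mod_cast hN
  have h := (Real.hasDerivAt_rpow_const (p := ((N : ℝ) - 2) / 2) (Or.inl hδ.ne')).mul
    (((hasDerivAt_id δ).div_const (twoStar N)).const_sub (1 / 2))
  refine h.congr_deriv ?_
  have hpow : δ ^ (((N : ℝ) - 2) / 2) = δ ^ (((N : ℝ) - 2) / 2 - 1) * δ := by
    rw [← Real.rpow_add_one hδ.ne', sub_add_cancel]
  have h2 : (N : ℝ) - 2 ≠ 0 := by linarith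
  have h3 : (N : ℝ) ≠ 0 := by linarith
  rw [hpow, twoStar]
  simp only [id_eq]
  field_simp
  ring

theorem strictMonoOn_depthFactor {N : ℕ} (hN : 3 ≤ N) :
    StrictMonoOn (depthFactor N) (Ioc 0 1) := by
  have hN' : (3 : ℝ) ≤ N := by exact_mod_cast hN
  refine strictMonoOn_of_deriv_pos (convex_Ioc 0 1)
    (fun δ hδ => (hasDerivAt_depthFactor hN hδ.1).continuousAt.continuousWithinAt) fun δ hδ => ?_
  rw [interior_Ioc] at hδ
  have hδ0 := hδ.1
  rw [(hasDerivAt_depthFactor hN hδ0).deriv]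
  exact mul_pos (mul_pos (by positivity) (by linarith)) (by linarith [hδ.2])

theorem strictAntiOn_depthFactor {N : ℕ} (hN : 3 ≤ N) :
    StrictAntiOn (depthFactor N) (Ici 1) := by
  have hN' : (3 : ℝ) ≤ N := by exact_mod_cast hN
  refine strictAntiOn_of_deriv_neg (convex_Ici 1)
    (fun δ hδ => (hasDerivAt_depthFactor hN
      (one_pos.trans_le hδ)).continuousAt.continuousWithinAt) fun δ hδ => ?_
  rw [interior_Ici] at hδ
  have hδ1 : 1 < δ := hδ
  have hδ0 : 0 < δ := one_pos.trans hδ1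
  rw [(hasDerivAt_depthFactor hN hδ0).deriv]
  exact mul_neg_of_pos_of_neg (mul_pos (by positivity) (by linarith)) (by linarith)

/-- monotonicity of δ ↦ d(δ): strictly increasing on (0,1],
strictly decreasing on [1,(p+1)/2), with maximum at δ = 1. -/
theorem ddepth_monotonicity (N : ℕ) (hN : 3 ≤ N) (μ : ℝ)
    (hμ : μ ∈ Set.Icc (0 : ℝ) (((N : ℝ) - 2) ^ 2 / 8)) :
    StrictMonoOn (ddepth N μ) (Set.Ioc (0 : ℝ) 1) ∧
    StrictAntiOn (ddepth N μ) (Set.Ico (1 : ℝ) (twoStar N / 2)) ∧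
    ∀ δ ∈ Set.Ioo (0 : ℝ) (twoStar N / 2), δ ≠ 1 → ddepth N μ δ < ddepth N μ 1 := by
  have hs := twoStar_gt_two hN
  have hC := sInf_Afun_nehari_pos hN hμ
  have hmono : StrictMonoOn (ddepth N μ) (Set.Ioc (0 : ℝ) 1) := by
    intro a ha b hb hab
    rw [ddepth_eq hN μ ha.1 (by linarith [ha.2]), ddepth_eq hN μ hb.1 (by linarith [hb.2])]
    exact mul_lt_mul_of_pos_right (strictMonoOn_depthFactor hN ha hb hab) hC
  have hanti : StrictAntiOn (ddepth N μ) (Set.Ico (1 : ℝ) (twoStar N / 2)) := by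
    intro a ha b hb hab
    rw [ddepth_eq hN μ (one_pos.trans_le ha.1) ha.2, ddepth_eq hN μ (one_pos.trans_le hb.1) hb.2]
    exact mul_lt_mul_of_pos_right (strictAntiOn_depthFactor hN ha.1 hb.1 hab) hC
  refine ⟨hmono, hanti, fun δ hδ hne => ?_⟩
  rcases hne.lt_or_gt with h | h
  · exact hmono ⟨hδ.1, h.le⟩ ⟨one_pos, le_rfl⟩ h
  · exact hanti ⟨le_rfl, by linarith⟩ ⟨h.le, hδ.2⟩ h
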